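/- arXiv:2210.10063 — 5 statements merged into one kernel-verified Lean document; each statement's English description precedes it below -/
import Mathlib

section
/- Let p be a positive integer, Σ a symmetric invertible real p×p matrix with inverse Ω = Σ⁻¹ having entries ω_{jk}, and x, μ ∈ ℝ^p. For every index k ∈ P = {1,…,p} and every subset S ⊆ P \ {k}, the marginal contribution of coordinate k satisfies Δ_k md²(x̂^S) := md²(x̂^{S∪{k}}) − md²(x̂^S) = 2(x_k − μ_k)·(Σ_{j ∈ S∪{k}} (x_j − μ_j) ω_{jk}) − (x_k − μ_k)² ω_{kk}. -/
open Matrix Finset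

/-- Squared Mahalanobis distance of `y` to `μ` with respect to `Sig`. -/
noncomputable def md2 {p : ℕ} (Sig : Matrix (Fin p) (Fin p) ℝ) (μ y : Fin p → ℝ) : ℝ :=
  (y - μ) ⬝ᵥ (Sig⁻¹ *ᵥ (y - μ))

/-- The vector `x̂^S`, equal to `x` on coordinates in `S` and to `μ` elsewhere. -/
def xhat {p : ℕ} (x μ : Fin p → ℝ) (S : Finset (Fin p)) : Fin p → ℝ :=
  fun j => if j ∈ S then x j else μ j

theorem md2_xhat_aux {p : ℕ} (Sig : Matrix (Fin p) (Fin p) ℝ) (x μ : Fin p → ℝ)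
    (S : Finset (Fin p)) :
    md2 Sig μ (xhat x μ S)
      = ∑ i ∈ S, ∑ j ∈ S, (x i - μ i) * (Sig⁻¹ i j * (x j - μ j)) := by
  have h : ∀ j, (xhat x μ S - μ) j = if j ∈ S then x j - μ j else 0 := by
    intro j
    by_cases hj : j ∈ S <;> simp [xhat, hj]
  simp only [md2, dotProduct, mulVec, h, mul_ite, ite_mul, mul_zero, zero_mul,
    Finset.sum_ite_mem, Finset.univ_inter]
  simp only [Finset.mul_sum]

theorem marginal_contribution_formula {p : ℕ} (hp : 0 < p)
    (Sig : Matrix (Fin p) (Fin p) ℝ) (hsym : Sig.IsSymm) (hinv : IsUnit Sig.det)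
    (x μ : Fin p → ℝ) (k : Fin p) (S : Finset (Fin p)) (hS : k ∉ S) :
    md2 Sig μ (xhat x μ (insert k S)) - md2 Sig μ (xhat x μ S)
      = 2 * (x k - μ k) * (∑ j ∈ insert k S, (x j - μ j) * Sig⁻¹ j k)
        - (x k - μ k) ^ 2 * Sig⁻¹ k k := by
  have hs : ∀ i j, Sig⁻¹ i j = Sig⁻¹ j i := fun i j => by
    have h : (Sig⁻¹)ᵀ = Sig⁻¹ := by rw [Matrix.transpose_nonsing_inv, hsym.eq]
    exact congrFun (congrFun h j) i
  rw [md2_xhat_aux, md2_xhat_aux]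
  simp only [Finset.sum_insert hS, Finset.sum_add_distrib]
  have h1 : ∑ j ∈ S, (x k - μ k) * (Sig⁻¹ k j * (x j - μ j))
      = (x k - μ k) * ∑ j ∈ S, (x j - μ j) * Sig⁻¹ j k := by
    rw [Finset.mul_sum]
    refine Finset.sum_congr rfl fun j _ => ?_
    rw [hs k j]; ring
  have h2 : ∑ j ∈ S, (x j - μ j) * (Sig⁻¹ j k * (x k - μ k))
      = (x k - μ k) * ∑ j ∈ S, (x j - μ j) * Sig⁻¹ j k := by
    rw [Finset.mul_sum]
    refine Finset.sum_congr rfl fun j _ => ?_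
    ring
  rw [h1, h2]
  ring
end

section
/- Let p be a positive integer, Σ a symmetric invertible real p×p matrix, and x, μ ∈ ℝ^p. The Shapley values φ_k(x, μ, Σ) := Σ_{S ⊆ P\{k}} (|S|!·(p − |S| − 1)!/p!)·(md²(x̂^{S∪{k}}) − md²(x̂^S)) satisfy the efficiency property: Σ_{k=1}^p φ_k(x, μ, Σ) = md²(x) = (x − μ)'Σ⁻¹(x − μ). -/
open Matrix Finset

/-- Shapley value coordinate `φ_k(x, μ, Σ)` of the game `v(S) = md²(x̂^S)`. -/
noncomputable def shapley {p : ℕ} (Sig : Matrix (Fin p) (Fin p) ℝ)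
    (x μ : Fin p → ℝ) (k : Fin p) : ℝ :=
  ∑ S ∈ ((Finset.univ : Finset (Fin p)).erase k).powerset,
    ((S.card.factorial * (p - S.card - 1).factorial : ℝ) / (p.factorial : ℝ)) *
      (md2 Sig μ (xhat x μ (insert k S)) - md2 Sig μ (xhat x μ S))

theorem shapley_general {p : ℕ} (hp : 0 < p) (v : Finset (Fin p) → ℝ) :
    ∑ k : Fin p, ∑ S ∈ ((Finset.univ : Finset (Fin p)).erase k).powerset,
      ((S.card.factorial * (p - S.card - 1).factorial : ℝ) / (p.factorial : ℝ)) *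
        (v (insert k S) - v S) = v Finset.univ - v ∅ := by
  have hpf : (p.factorial : ℝ) ≠ 0 := by exact_mod_cast Nat.factorial_ne_zero p
  have hset : ∀ k : Fin p, ((Finset.univ : Finset (Fin p)).erase k).powerset
      = Finset.univ.filter (fun S => k ∉ S) := by
    intro k
    ext S
    simp [Finset.subset_erase]
  have hA : ∑ k : Fin p, ∑ S ∈ Finset.univ.filter (fun S : Finset (Fin p) => k ∉ S),
      ((S.card.factorial * (p - S.card - 1).factorial : ℝ) / (p.factorial : ℝ)) *
        v (insert k S) =
      ∑ T : Finset (Fin p), (((T.card.factorial * (p - T.card).factorial : ℝ) / (p.factorial : ℝ))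
        * v T - if T = ∅ then v T else 0) := by
    have h1 : ∀ k : Fin p, ∑ S ∈ Finset.univ.filter (fun S : Finset (Fin p) => k ∉ S),
      ((S.card.factorial * (p - S.card - 1).factorial : ℝ) / (p.factorial : ℝ)) *
        v (insert k S) = ∑ T ∈ Finset.univ.filter (fun S : Finset (Fin p) => k ∈ S),
      (((T.card - 1).factorial * (p - T.card).factorial : ℝ) / (p.factorial : ℝ)) * v T := by
      intro k
      refine Finset.sum_bij' (fun S _ => insert k S) (fun T _ => T.erase k) ?_ ?_ ?_ ?_ ?_
      · intro S _; simp
      · intro S _; simp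
      · intro S hS; exact Finset.erase_insert (by simpa using hS)
      · intro S hS; exact Finset.insert_erase (by simpa using hS)
      · intro S hS
        have hS' : k ∉ S := by simpa using hS
        simp [Finset.card_insert_of_notMem hS', Nat.sub_sub]
    simp_rw [h1, Finset.sum_filter]
    rw [Finset.sum_comm]
    refine Finset.sum_congr rfl fun T _ => ?_
    rw [← Finset.sum_filter]
    simp only [Finset.filter_univ_mem, Finset.sum_const, nsmul_eq_mul]
    by_cases hT : T = ∅
    · subst hT
      simp [hpf]
    · have hc : T.card ≠ 0 := by simpa using hT
      rw [if_neg hT, ← Nat.mul_factorial_pred hc]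
      push_cast
      ring
  have hB : ∑ k : Fin p, ∑ S ∈ Finset.univ.filter (fun S : Finset (Fin p) => k ∉ S),
      ((S.card.factorial * (p - S.card - 1).factorial : ℝ) / (p.factorial : ℝ)) * v S =
      ∑ T : Finset (Fin p), (((T.card.factorial * (p - T.card).factorial : ℝ) / (p.factorial : ℝ))
        * v T - if T = Finset.univ then v T else 0) := by
    simp_rw [Finset.sum_filter]
    rw [Finset.sum_comm]
    refine Finset.sum_congr rfl fun T _ => ?_
    rw [← Finset.sum_filter]
    have hf : (Finset.univ.filter (fun k => k ∉ T)).card = p - T.card := by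
      have : Finset.univ.filter (fun k => k ∉ T) = Tᶜ := by ext; simp
      rw [this, Finset.card_compl, Fintype.card_fin]
    rw [Finset.sum_const, nsmul_eq_mul, hf]
    by_cases hT : T = Finset.univ
    · subst hT
      simp [hpf]
    · have hc : p - T.card ≠ 0 := by
        have := (Finset.card_lt_iff_ne_univ T).2 hT
        rw [Fintype.card_fin] at this
        omega
      rw [if_neg hT, ← Nat.mul_factorial_pred hc]
      push_cast
      ring
  simp_rw [hset, mul_sub, Finset.sum_sub_distrib]
  rw [hA, hB, Finset.sum_sub_distrib, Finset.sum_sub_distrib]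
  simp

theorem shapley_efficiency {p : ℕ} (hp : 0 < p)
    (Sig : Matrix (Fin p) (Fin p) ℝ) (hsym : Sig.IsSymm) (hinv : IsUnit Sig.det)
    (x μ : Fin p → ℝ) :
    ∑ k : Fin p, shapley Sig x μ k = md2 Sig μ x ∧
      md2 Sig μ x = (x - μ) ⬝ᵥ (Sig⁻¹ *ᵥ (x - μ)) := by
  refine ⟨?_, rfl⟩
  have h := shapley_general hp (fun S => md2 Sig μ (xhat x μ S))
  have h1 : xhat x μ Finset.univ = x := by ext j; simp [xhat]
  have h0 : xhat x μ ∅ = μ := by ext j; simp [xhat]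
  simp only [h1, h0] at h
  have h2 : md2 Sig μ μ = 0 := by simp [md2]
  rw [h2, sub_zero] at h
  exact h
end

section
/- Let p be a positive integer, Σ a symmetric invertible real p×p matrix with inverse Ω = Σ⁻¹ having entries ω_{jk}, x, μ ∈ ℝ^p, and let j, k ∈ P = {1,…,p} be distinct. For every subset T ⊆ P \ {j,k}, the second-order set function derivative satisfies Δ_{{j,k}} md²(x̂^T) := md²(x̂^{T∪{j,k}}) − md²(x̂^{T∪{j}}) − md²(x̂^{T∪{k}}) + md²(x̂^T) = 2(x_j − μ_j)(x_k − μ_k) ω_{jk}; in particular this quantity does not depend on T. -/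
open Matrix Finset

theorem second_order_derivative_formula {p : ℕ} (hp : 0 < p)
    (Sig : Matrix (Fin p) (Fin p) ℝ) (hsym : Sig.IsSymm) (hinv : IsUnit Sig.det)
    (x μ : Fin p → ℝ) (j k : Fin p) (hjk : j ≠ k)
    (T : Finset (Fin p)) (hTj : j ∉ T) (hTk : k ∉ T) :
    md2 Sig μ (xhat x μ (insert j (insert k T)))
      - md2 Sig μ (xhat x μ (insert j T))
      - md2 Sig μ (xhat x μ (insert k T))
      + md2 Sig μ (xhat x μ T)
      = 2 * (x j - μ j) * (x k - μ k) * Sig⁻¹ j k := by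
  have hO : Sig⁻¹ k j = Sig⁻¹ j k := by
    have h : (Sig⁻¹)ᵀ = Sig⁻¹ := by rw [Matrix.transpose_nonsing_inv, hsym.eq]
    exact congrFun (congrFun h j) k
  have step : ∀ (i : Fin p) (S : Finset (Fin p)), i ∉ S →
      xhat x μ (insert i S) - μ = (xhat x μ S - μ) + Pi.single i (x i - μ i) := by
    intro i S hi
    funext l
    by_cases hl : l = i
    · subst hl
      simp [xhat, hi]
    · simp [xhat, hl]
  have hj : j ∉ insert k T := by simp [hjk, hTj]
  unfold md2
  rw [step j _ hj, step j T hTj, step k T hTk]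
  simp only [Matrix.mulVec_add, add_dotProduct, dotProduct_add]
  have e : ∀ (a b : Fin p) (c d : ℝ),
      (Pi.single a c : Fin p → ℝ) ⬝ᵥ (Sig⁻¹ *ᵥ Pi.single b d) = c * Sig⁻¹ a b * d := by
    intro a b c d
    simp [single_dotProduct, Matrix.mulVec_single]
    ring
  simp only [e, hO]
  ring
end

section
/- Let p ≥ 2 be an integer, Σ a symmetric invertible real p×p matrix with inverse Ω = Σ⁻¹ having entries ω_{jk}, x, μ ∈ ℝ^p, and let j, k ∈ P = {1,…,p} be distinct. Then the pairwise Shapley interaction index Φ_{jk}(x) := Σ_{T ⊆ P\{j,k}} (|T|!·(p − |T| − 2)!/(p − 1)!)·(md²(x̂^{T∪{j,k}}) − md²(x̂^{T∪{j}}) − md²(x̂^{T∪{k}}) + md²(x̂^T)) equals 2(x_j − μ_j)(x_k − μ_k) ω_{jk}. -/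
open Matrix Finset

theorem xhat_insert_sub {p : ℕ} (x μ : Fin p → ℝ) (S : Finset (Fin p)) (a : Fin p)
    (ha : a ∉ S) :
    xhat x μ (insert a S) - μ = (xhat x μ S - μ) + Pi.single a (x a - μ a) := by
  funext i
  by_cases h : i = a
  · subst h
    simp [xhat, ha]
  · simp [xhat, h]

theorem shapley_weight_sum {p : ℕ} (hp : 2 ≤ p) (s : Finset (Fin p)) (hs : s.card = p - 2) :
    ∑ T ∈ s.powerset,
      ((T.card.factorial * (p - T.card - 2).factorial : ℝ) / ((p - 1).factorial : ℝ)) = 1 := by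
  obtain ⟨n, rfl⟩ : ∃ n, p = n + 2 := ⟨p - 2, by omega⟩
  have hn : s.card = n := by omega
  rw [Finset.sum_powerset_apply_card (fun m =>
    ((m.factorial * (n + 2 - m - 2).factorial : ℝ) / ((n + 2 - 1).factorial : ℝ))), hn]
  have h : ∀ m ∈ Finset.range (n + 1), n.choose m •
      ((m.factorial * (n + 2 - m - 2).factorial : ℝ) / ((n + 2 - 1).factorial : ℝ))
      = 1 / (n + 1 : ℝ) := by
    intro m hm
    have hm' : m ≤ n := by simpa [Nat.lt_succ_iff] using hm
    have e : n + 2 - m - 2 = n - m := by omega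
    have e2 : n + 2 - 1 = n + 1 := by omega
    have key := Nat.choose_mul_factorial_mul_factorial hm'
    have key' : (n.choose m : ℝ) * m.factorial * (n - m).factorial = n.factorial := by
      exact_mod_cast key
    rw [e, e2, nsmul_eq_mul, Nat.factorial_succ, ← mul_div_assoc, ← mul_assoc, key']
    have : (n.factorial : ℝ) ≠ 0 := by positivity
    push_cast
    field_simp
  rw [Finset.sum_congr rfl h]
  simp
  field_simp

theorem pairwise_shapley_interaction_formula {p : ℕ} (hp : 2 ≤ p)
    (Sig : Matrix (Fin p) (Fin p) ℝ) (hsym : Sig.IsSymm) (hinv : IsUnit Sig.det)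
    (x μ : Fin p → ℝ) (j k : Fin p) (hjk : j ≠ k) :
    ∑ T ∈ (((Finset.univ : Finset (Fin p)).erase j).erase k).powerset,
        ((T.card.factorial * (p - T.card - 2).factorial : ℝ) / ((p - 1).factorial : ℝ)) *
          (md2 Sig μ (xhat x μ (insert j (insert k T)))
            - md2 Sig μ (xhat x μ (insert j T))
            - md2 Sig μ (xhat x μ (insert k T))
            + md2 Sig μ (xhat x μ T))
      = 2 * (x j - μ j) * (x k - μ k) * Sig⁻¹ j k := by
  have hsymm : Sig⁻¹ k j = Sig⁻¹ j k := by
    have h : (Sig⁻¹)ᵀ = Sig⁻¹ := by rw [Matrix.transpose_nonsing_inv, hsym.eq]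
    exact congrFun (congrFun h j) k
  have hD : ∀ T ∈ (((Finset.univ : Finset (Fin p)).erase j).erase k).powerset,
      ((T.card.factorial * (p - T.card - 2).factorial : ℝ) / ((p - 1).factorial : ℝ)) *
          (md2 Sig μ (xhat x μ (insert j (insert k T)))
            - md2 Sig μ (xhat x μ (insert j T))
            - md2 Sig μ (xhat x μ (insert k T))
            + md2 Sig μ (xhat x μ T))
      = ((T.card.factorial * (p - T.card - 2).factorial : ℝ) / ((p - 1).factorial : ℝ)) *
          (2 * (x j - μ j) * (x k - μ k) * Sig⁻¹ j k) := by
    intro T hT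
    rw [Finset.mem_powerset] at hT
    have hk : k ∉ T := fun h => by simpa using hT h
    have hj : j ∉ T := fun h => by simpa using hT h
    have hj' : j ∉ insert k T := by simp [hj, hjk]
    congr 1
    unfold md2
    rw [xhat_insert_sub x μ _ j hj', xhat_insert_sub x μ _ j hj, xhat_insert_sub x μ _ k hk]
    simp only [Matrix.mulVec_add, add_dotProduct, dotProduct_add]
    have hc : ∀ (a b : Fin p) (s t : ℝ),
        (Pi.single a s : Fin p → ℝ) ⬝ᵥ (Sig⁻¹ *ᵥ (Pi.single b t)) = s * t * Sig⁻¹ a b := by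
      intro a b s t
      simp [Matrix.mulVec_single]
      ring
    rw [hc j k, hc k j, hsymm]
    ring
  rw [Finset.sum_congr rfl hD, ← Finset.sum_mul, shapley_weight_sum hp, one_mul]
  rw [Finset.card_erase_of_mem (by simp [hjk.symm]), Finset.card_erase_of_mem (by simp)]
  simp
  omega
end

section
/- Let p be a positive integer, Σ a symmetric positive definite real p×p matrix with inverse Ω = Σ⁻¹ having entries ω_{jk}, x, μ ∈ ℝ^p, and j ∈ {1,…,p}. Then ω_{jj} > 0 and the value β̂(j) := (1/ω_{jj})·Σ_{i=1}^p ω_{ji}(x_i − μ_i) minimizes the squared Mahalanobis distance after shifting only the j-th coordinate: for every t ∈ ℝ, md²(x − β̂(j)·e_j) ≤ md²(x − t·e_j), where e_j is the j-th standard basis vector and md²(y) = (y − μ)'Σ⁻¹(y − μ). -/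
open Matrix Finset

theorem mahalanobis_single_coordinate_least_squares {p : ℕ} (hp : 0 < p)
    (Sig : Matrix (Fin p) (Fin p) ℝ) (hSig : Sig.PosDef)
    (x μ : Fin p → ℝ) (j : Fin p) :
    0 < Sig⁻¹ j j ∧
      ∀ t : ℝ,
        md2 Sig μ (x - ((1 / Sig⁻¹ j j) * ∑ i, Sig⁻¹ j i * (x i - μ i)) • (Pi.single j 1 : Fin p → ℝ))
          ≤ md2 Sig μ (x - t • (Pi.single j 1 : Fin p → ℝ)) := by
  have hΩ := hSig.inv
  have hpos : 0 < Sig⁻¹ j j := hΩ.diag_pos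
  refine ⟨hpos, fun t => ?_⟩
  have hsymm : ∀ a b, Sig⁻¹ a b = Sig⁻¹ b a := fun a b => by
    simpa using (hΩ.isHermitian.apply a b).symm
  set A := Sig⁻¹ with hA
  set S := ∑ i, A j i * (x i - μ i) with hS
  have hrow : (A *ᵥ (x - μ)) j = S := by
    simp [Matrix.mulVec, dotProduct, hS]
  have hcol : (x - μ) ⬝ᵥ (A *ᵥ (Pi.single j 1 : Fin p → ℝ)) = S := by
    simp only [Matrix.mulVec_single_one, dotProduct, hS, Matrix.col_apply, Pi.sub_apply]
    exact Finset.sum_congr rfl fun i _ => by rw [hsymm i j, mul_comm]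
  have key : ∀ s : ℝ, md2 Sig μ (x - s • (Pi.single j 1 : Fin p → ℝ))
      = (x - μ) ⬝ᵥ (A *ᵥ (x - μ)) - 2 * s * S + s ^ 2 * A j j := by
    intro s
    have h1 : x - s • (Pi.single j 1 : Fin p → ℝ) - μ
        = (x - μ) - s • (Pi.single j 1 : Fin p → ℝ) := by abel
    have h2 : (A *ᵥ (Pi.single j 1 : Fin p → ℝ)) j = A j j := by simp
    rw [md2, ← hA, h1, Matrix.mulVec_sub, Matrix.mulVec_smul, sub_dotProduct, dotProduct_sub,
      dotProduct_sub, smul_dotProduct, smul_dotProduct, dotProduct_smul, dotProduct_smul, hcol,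
      single_one_dotProduct, single_one_dotProduct, hrow, h2]
    simp only [smul_eq_mul]
    ring
  rw [key, key]
  have hsq : 0 ≤ A j j * (t - 1 / A j j * S) ^ 2 := by positivity
  have hne : A j j * (1 / A j j * S) = S := by field_simp
  generalize 1 / A j j * S = b at *
  rw [← hne]
  nlinarith [hsq]
end
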